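/- arXiv:1305.3238 — 2 statements merged into one kernel-verified Lean document; each statement's English description precedes it below -/
import Mathlib

section
/- Let r ≥ 1 be an integer, let α be a real number with 0 < α < 1, and let s be a complex number with s ≠ 0 and s ≠ 1. Then the function x ↦ ζ^{(r)}(s,x) of the real variable x has derivative −r·ζ^{(r−1)}(s+1,α) − s·ζ^{(r)}(s+1,α) at x = α; i.e. HasDerivAt (fun x : ℝ => iteratedDeriv r (fun w => ζ(w,x)) s) (−(r:ℂ)·iteratedDeriv (r−1) (fun w => ζ(w,α)) (s+1) − s·iteratedDeriv r (fun w => ζ(w,α)) (s+1)) α. -/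
open Set Filter Topology MeasureTheory
open scoped Interval

lemma aux_loc {T : Type*} [TopologicalSpace T] {f : ℂ → T → ℂ} {U : Set ℂ} {V : Set T}
    (hf : ContinuousOn (fun p : ℂ × T => f p.1 p.2) (U ×ˢ V)) {t0 : T} (ht : t0 ∈ V) :
    TendstoLocallyUniformlyOn (fun t s => f s t) (fun s => f s t0) (𝓝[V] t0) U := by
  rw [Metric.tendstoLocallyUniformlyOn_iff]
  intro ε hε s0 hs0
  have h := hf (s0, t0) ⟨hs0, ht⟩
  have h2 := Metric.tendsto_nhds.1 h (ε / 2) (by positivity)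
  rw [nhdsWithin_prod_eq] at h2
  obtain ⟨pa, ha, pb, hb, hab⟩ := eventually_prod_iff.1 h2
  refine ⟨{s | pa s}, ha, ?_⟩
  have hb0 : pb t0 := hb.self_of_nhdsWithin ht
  filter_upwards [hb] with t htb s hs
  have h3 := hab hs htb
  have h4 := hab hs hb0
  have := dist_triangle_right (f s t0) (f s t) (f s0 t0)
  simp only at h3 h4
  linarith

lemma aux_iter {T : Type*} {l : Filter T} {U : Set ℂ} (hU : IsOpen U) (r : ℕ) :
    ∀ {F : T → ℂ → ℂ} {f : ℂ → ℂ}, TendstoLocallyUniformlyOn F f l U →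
    (∀ᶠ n in l, DifferentiableOn ℂ (F n) U) →
    TendstoLocallyUniformlyOn (fun t => iteratedDeriv r (F t)) (iteratedDeriv r f) l U := by
  induction r with
  | zero => intro F f h _; simpa [iteratedDeriv_zero] using h
  | succ r ih =>
    intro F f h hd
    simp only [iteratedDeriv_succ']
    exact ih (h.deriv hd hU) (hd.mono fun n hn => hn.deriv hU)

lemma aux_clamp {X : Type*} [TopologicalSpace X] {F : X → ℝ → ℂ} {W : Set X}
    (hF : ContinuousOn (fun p : X × ℝ => F p.1 p.2) (W ×ˢ Icc (0:ℝ) 1)) :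
    ContinuousOn (fun p : X × ℝ => F p.1 (projIcc 0 1 zero_le_one p.2)) (W ×ˢ univ) := by
  have : ContinuousOn (fun p : X × ℝ => (p.1, (projIcc (0:ℝ) 1 zero_le_one p.2 : ℝ))) (W ×ˢ univ) :=
    (continuous_fst.prodMk (continuous_subtype_val.comp
      (continuous_projIcc.comp continuous_snd))).continuousOn
  exact hF.comp this (fun p hp => ⟨hp.1, Subtype.coe_prop _⟩)

lemma aux_int_clamp (f : ℝ → ℂ) :
    ∫ u in (0:ℝ)..1, f u = ∫ u in (0:ℝ)..1, f (projIcc 0 1 zero_le_one u) := by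
  apply intervalIntegral.integral_congr
  intro u hu
  rw [uIcc_of_le zero_le_one] at hu
  simp [projIcc_of_mem _ hu]

lemma aux_cont {X : Type*} [TopologicalSpace X] {F : X → ℝ → ℂ} {W : Set X}
    (hF : ContinuousOn (fun p : X × ℝ => F p.1 p.2) (W ×ˢ Icc (0:ℝ) 1)) :
    ContinuousOn (fun p => ∫ u in (0:ℝ)..1, F p u) W := by
  have h := aux_clamp hF
  rw [show (fun p => ∫ u in (0:ℝ)..1, F p u) = _ from funext fun p => aux_int_clamp (F p)]
  rw [continuousOn_iff_continuous_domRestrict]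
  refine intervalIntegral.continuous_parametric_intervalIntegral_of_continuous'
    (f := fun (p : W) u => F p (projIcc 0 1 zero_le_one u)) ?_ 0 1
  exact h.comp_continuous (f := fun q : W × ℝ => ((q.1 : X), q.2)) (by fun_prop)
    (fun q => ⟨q.1.2, mem_univ _⟩)

lemma aux_diff {F : ℂ → ℝ → ℂ} {U : Set ℂ} (hU : IsOpen U)
    (hF : ContinuousOn (fun p : ℂ × ℝ => F p.1 p.2) (U ×ˢ Icc (0:ℝ) 1))
    (hd : ∀ u ∈ Icc (0:ℝ) 1, DifferentiableOn ℂ (fun s => F s u) U) :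
    DifferentiableOn ℂ (fun s => ∫ u in (0:ℝ)..1, F s u) U := by
  intro s0 hs0
  obtain ⟨R, hR, hRU⟩ := Metric.nhds_basis_closedBall.mem_iff.1 (hU.mem_nhds hs0)
  have hcomp : IsCompact (Metric.closedBall s0 R ×ˢ Icc (0:ℝ) 1) :=
    (isCompact_closedBall s0 R).prod isCompact_Icc
  obtain ⟨M, hM⟩ := hcomp.exists_bound_of_continuousOn (hF.mono (prod_mono hRU subset_rfl))
  have hc : ∀ s ∈ U, ContinuousOn (F s) (Icc (0:ℝ) 1) := fun s hs =>
    hF.comp (f := fun u : ℝ => (s, u)) (by fun_prop) (fun u hu => ⟨hs, hu⟩)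
  have hsub : Ι (0:ℝ) 1 ⊆ Icc 0 1 := by
    rw [uIoc_of_le zero_le_one]; exact Ioc_subset_Icc_self
  refine (intervalIntegral.hasDerivAt_integral_of_dominated_loc_of_deriv_le
    (F' := fun s u => deriv (fun s => F s u) s) (bound := fun _ => M / (R / 2))
    (Metric.ball_mem_nhds s0 (half_pos hR)) ?_ ?_ ?_ ?_ ?_ ?_).2.differentiableAt.differentiableWithinAt
  · filter_upwards [hU.mem_nhds hs0] with s hs
    exact ((hc s hs).mono hsub).aestronglyMeasurable measurableSet_uIoc
  · exact (by simpa using hc s0 hs0 : ContinuousOn (F s0) (uIcc 0 1)).intervalIntegrable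
  · refine ContinuousOn.aestronglyMeasurable ?_ measurableSet_uIoc
    refine ContinuousOn.mono ?_ hsub
    intro u hu
    have h1 := (aux_loc hF hu).deriv
      (eventually_of_mem self_mem_nhdsWithin fun v hv => hd v hv) hU
    exact h1.tendsto_at hs0
  · refine ae_of_all _ fun u hu s hs => ?_
    have hcb : Metric.closedBall s (R/2) ⊆ Metric.closedBall s0 R := by
      apply Metric.closedBall_subset_closedBall'
      have := Metric.mem_ball.1 hs
      linarith
    refine Complex.norm_deriv_le_of_forall_mem_sphere_norm_le (half_pos hR) ?_ ?_
    · refine DifferentiableOn.diffContOnCl ?_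
      refine (hd u (hsub hu)).mono ?_
      exact (Metric.closure_ball_subset_closedBall.trans hcb).trans hRU
    · intro z hz
      exact hM (z, u) ⟨hcb (Metric.sphere_subset_closedBall hz), hsub hu⟩
  · exact intervalIntegrable_const
  · refine ae_of_all _ fun u hu s hs => ?_
    have : s ∈ U := hRU (Metric.ball_subset_closedBall
      (Metric.ball_subset_ball (by linarith) hs))
    exact ((hd u (hsub hu)).differentiableAt (hU.mem_nhds this)).hasDerivAt

lemma aux_split {x : ℝ} (hx : x ∈ Ioo (0:ℝ) 1) {s : ℂ} (hs : 1 < s.re) :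
    HurwitzZeta.hurwitzZeta (x : UnitAddCircle) s =
      (x:ℂ) ^ (-s) + ∑' n : ℕ, ((n:ℂ) + 1 + x) ^ (-s) := by
  have h := HurwitzZeta.hasSum_hurwitzZeta_of_one_lt_re (a := x) ⟨hx.1.le, hx.2.le⟩ hs
  rw [← h.tsum_eq, h.summable.tsum_eq_zero_add]
  simp [Complex.cpow_neg]

lemma aux_bound (n : ℕ) {x σ : ℝ} (hx : x ∈ Ioo (0:ℝ) 1) (hσ : 0 < σ) {s : ℂ} (hs : σ ≤ s.re) :
    ‖((n:ℂ) + 1 + x) ^ (-s)‖ ≤ ((n:ℝ) + 1) ^ (-σ) := by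
  have h0 : (0:ℝ) < n + 1 + x := by have := hx.1; positivity
  have h1 : ((n:ℂ) + 1 + x) = ((n + 1 + x : ℝ) : ℂ) := by push_cast; ring
  rw [h1, Complex.norm_cpow_eq_rpow_re_of_pos h0]
  have hn : (0:ℝ) ≤ n := by positivity
  calc ((n:ℝ) + 1 + x) ^ (-s).re ≤ ((n:ℝ) + 1 + x) ^ (-σ) := by
        apply Real.rpow_le_rpow_of_exponent_le
        · linarith [hx.1]
        · simpa using hs
    _ ≤ _ := by
        apply Real.rpow_le_rpow_of_nonpos (by positivity) (by linarith [hx.1]) (by linarith)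

lemma aux_summable {σ : ℝ} (hσ : 1 < σ) : Summable fun n : ℕ => ((n:ℝ) + 1) ^ (-σ) := by
  have := (Real.summable_nat_rpow (p := -σ)).2 (by linarith)
  simpa using (summable_nat_add_iff 1).2 this

lemma aux_slit (n : ℕ) {x : ℝ} (hx : x ∈ Ioo (0:ℝ) 1) : ((n:ℂ) + 1 + x) ∈ Complex.slitPlane := by
  left
  have := hx.1
  simp
  positivity

lemma aux_Zcont : ContinuousOn
    (fun p : ℂ × ℝ => HurwitzZeta.hurwitzZeta (p.2 : UnitAddCircle) p.1)
    ({s : ℂ | 1 < s.re} ×ˢ Ioo (0:ℝ) 1) := by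
  have hmain : ∀ σ : ℝ, 1 < σ → ContinuousOn
    (fun p : ℂ × ℝ => HurwitzZeta.hurwitzZeta (p.2 : UnitAddCircle) p.1)
    ({s : ℂ | σ < s.re} ×ˢ Ioo (0:ℝ) 1) := by
    intro σ hσ
    have : ContinuousOn (fun p : ℂ × ℝ => (p.2:ℂ) ^ (-p.1) + ∑' n : ℕ, ((n:ℂ) + 1 + p.2) ^ (-p.1))
        ({s : ℂ | σ < s.re} ×ˢ Ioo (0:ℝ) 1) := by
      refine ContinuousOn.add ?_ (continuousOn_tsum (fun n => ?_) (aux_summable hσ) ?_)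
      · refine ContinuousOn.cpow (by fun_prop) (by fun_prop) ?_
        intro p hp
        left; simpa using hp.2.1
      · refine ContinuousOn.cpow (by fun_prop) (by fun_prop) ?_
        intro p hp
        exact aux_slit n hp.2
      · intro n p hp
        exact aux_bound n hp.2 (by linarith) (le_of_lt hp.1)
    refine this.congr fun p hp => ?_
    exact aux_split hp.2 (lt_trans hσ hp.1)
  intro p hp
  have h1 : 1 < p.1.re := hp.1
  obtain ⟨σ, h2, h3⟩ := exists_between h1
  have hopen : IsOpen ({s : ℂ | σ < s.re} ×ˢ Ioo (0:ℝ) 1) :=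
    (isOpen_lt continuous_const Complex.continuous_re).prod isOpen_Ioo
  exact ((hmain σ h2).continuousAt (hopen.mem_nhds ⟨h3, hp.2⟩)).continuousWithinAt

lemma aux_Zderiv {s : ℂ} (hs : 1 < s.re) {x : ℝ} (hx : x ∈ Ioo (0:ℝ) 1) :
    HasDerivAt (fun x : ℝ => HurwitzZeta.hurwitzZeta (x : UnitAddCircle) s)
      (-s * HurwitzZeta.hurwitzZeta (x : UnitAddCircle) (s + 1)) x := by
  have hd : ∀ (c : ℂ) (y : ℝ), c + y ∈ Complex.slitPlane →
      HasDerivAt (fun y : ℝ => (c + y) ^ (-s)) (-s * (c + y) ^ (-(s+1))) y := by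
    intro c y hy
    have h1 : HasDerivAt (fun z : ℂ => c + z) 1 (y:ℂ) := (hasDerivAt_id (y:ℂ)).const_add c
    have := (h1.cpow_const (c := -s) hy).comp_ofReal
    convert this using 1
    rw [mul_one]; congr 2; ring
  have hT := hasDerivAt_tsum_of_isPreconnected (𝕜 := ℝ) (t := Ioo (0:ℝ) 1)
    (g := fun (n : ℕ) (y : ℝ) => ((n:ℂ) + 1 + y) ^ (-s))
    (g' := fun (n : ℕ) (y : ℝ) => -s * ((n:ℂ) + 1 + y) ^ (-(s+1)))
    (u := fun n : ℕ => ‖s‖ * ((n:ℝ) + 1) ^ (-s.re)) ((aux_summable hs).mul_left _) isOpen_Ioo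
    isPreconnected_Ioo (fun n y hy => hd _ y (aux_slit n hy))
    (fun n y hy => by
      rw [norm_mul, norm_neg]
      gcongr
      exact aux_bound n hy (by linarith) (by simp)) hx
    (Summable.of_norm_bounded (aux_summable hs) fun n => aux_bound n hx (by linarith) le_rfl) hx
  have h0 := hd 0 x (by left; simpa using hx.1)
  have := h0.add hT
  rw [aux_split hx (s := s + 1) (by simp; linarith), mul_add, ← tsum_mul_left]
  simp only [zero_add] at this
  refine this.congr_of_eventuallyEq ?_
  filter_upwards [isOpen_Ioo.mem_nhds hx] with y hy
  simp [aux_split hy hs]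

noncomputable def gg (x : ℝ) : ℂ → ℂ :=
  Function.update (fun s => (s - 1) * HurwitzZeta.hurwitzZeta (x : UnitAddCircle) s) 1 1

lemma gg_of_ne (x : ℝ) {s : ℂ} (hs : s ≠ 1) :
    gg x s = (s - 1) * HurwitzZeta.hurwitzZeta (x : UnitAddCircle) s := by
  simp [gg, hs]

lemma gg_diff (x : ℝ) : Differentiable ℂ (gg x) := by
  have hne : ∀ s : ℂ, s ≠ 1 → DifferentiableAt ℂ (gg x) s := by
    intro s hs
    have : DifferentiableAt ℂ
        (fun s => (s - 1) * HurwitzZeta.hurwitzZeta (x : UnitAddCircle) s) s :=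
      (by fun_prop : DifferentiableAt ℂ (fun s : ℂ => s - 1) s).mul
        (HurwitzZeta.differentiableAt_hurwitzZeta _ hs)
    refine this.congr_of_eventuallyEq ?_
    filter_upwards [isOpen_ne.mem_nhds hs] with w hw
    exact gg_of_ne x hw
  intro s
  rcases eq_or_ne s 1 with rfl | hs
  · refine (Complex.analyticAt_of_differentiable_on_punctured_nhds_of_continuousAt
      ?_ ?_).differentiableAt
    · filter_upwards [self_mem_nhdsWithin] with w hw using hne w hw
    · exact continuousAt_update_same.2 (HurwitzZeta.hurwitzZeta_residue_one _)
  · exact hne s hs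

lemma seg_mem {x y u : ℝ} (hx : x ∈ Ioo (0:ℝ) 1) (hy : y ∈ Ioo (0:ℝ) 1) (hu : u ∈ Icc (0:ℝ) 1) :
    x + u * (y - x) ∈ Ioo (0:ℝ) 1 := by
  have := (convex_Ioo (0:ℝ) 1).add_smul_sub_mem hx hy hu
  simpa using this

def HP (c : ℝ) : Prop := ContinuousOn (fun p : ℂ × ℝ => gg p.2 p.1)
  ({s : ℂ | c < s.re} ×ˢ Ioo (0:ℝ) 1)

lemma HP_one : HP 1 := by
  have : ContinuousOn (fun p : ℂ × ℝ => (p.1 - 1) *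
      HurwitzZeta.hurwitzZeta (p.2 : UnitAddCircle) p.1) ({s : ℂ | 1 < s.re} ×ˢ Ioo (0:ℝ) 1) :=
    ContinuousOn.mul (by fun_prop) aux_Zcont
  refine this.congr fun p hp => gg_of_ne _ ?_
  rintro h
  have := hp.1
  simp [h] at this

lemma HP_K {c : ℝ} (h : HP (c + 1)) : ContinuousOn
    (fun q : ℂ × ℝ × ℝ => ∫ u in (0:ℝ)..1, gg (q.2.1 + u * (q.2.2 - q.2.1)) (q.1 + 1))
    ({s : ℂ | c < s.re} ×ˢ (Ioo (0:ℝ) 1 ×ˢ Ioo (0:ℝ) 1)) := by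
  apply aux_cont (F := fun (q : ℂ × ℝ × ℝ) u => gg (q.2.1 + u * (q.2.2 - q.2.1)) (q.1 + 1))
  exact ContinuousOn.comp h (f := fun p : (ℂ × ℝ × ℝ) × ℝ =>
    (p.1.1 + 1, p.1.2.1 + p.2 * (p.1.2.2 - p.1.2.1))) (by fun_prop)
    (fun p hp => ⟨by have := hp.1.1; simp at this ⊢; linarith,
      seg_mem hp.1.2.1 hp.1.2.2 hp.2⟩)

lemma isOpen_hp (c : ℝ) : IsOpen {s : ℂ | c < s.re} :=
  isOpen_lt continuous_const Complex.continuous_re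

lemma HP_Kd {c : ℝ} (h : HP (c + 1)) {x y : ℝ} (hx : x ∈ Ioo (0:ℝ) 1) (hy : y ∈ Ioo (0:ℝ) 1) :
    DifferentiableOn ℂ (fun s => ∫ u in (0:ℝ)..1, gg (x + u * (y - x)) (s + 1))
      {s : ℂ | c < s.re} := by
  refine aux_diff (isOpen_hp c) ?_ ?_
  · exact ContinuousOn.comp h (f := fun p : ℂ × ℝ =>
      (p.1 + 1, x + p.2 * (y - x))) (by fun_prop)
      (fun p hp => ⟨by have := hp.1; simp at this ⊢; linarith, seg_mem hx hy hp.2⟩)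
  · intro u _
    exact ((gg_diff _).comp (by fun_prop : Differentiable ℂ (fun s : ℂ => s + 1))).differentiableOn

lemma base_id {s : ℂ} (hs : 1 < s.re) {x y : ℝ} (hx : x ∈ Ioo (0:ℝ) 1) (hy : y ∈ Ioo (0:ℝ) 1) :
    gg y s = gg x s - (s - 1) * (y - x) * ∫ u in (0:ℝ)..1, gg (x + u * (y - x)) (s + 1) := by
  have hs1 : s ≠ 1 := by rintro rfl; simp at hs
  have hs0 : s ≠ 0 := by rintro rfl; simp at hs; linarith
  have hD : ∀ u ∈ uIcc (0:ℝ) 1, HasDerivAt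
      (fun u : ℝ => HurwitzZeta.hurwitzZeta ((x + u * (y - x) : ℝ) : UnitAddCircle) s)
      (-((y - x : ℝ) : ℂ) * gg (x + u * (y - x)) (s + 1)) u := by
    intro u hu
    rw [uIcc_of_le zero_le_one] at hu
    have h1 : HasDerivAt (fun u : ℝ => x + u * (y - x)) (y - x) u := by
      simpa using ((hasDerivAt_id u).mul_const (y - x)).const_add x
    have := (aux_Zderiv hs (seg_mem hx hy hu)).scomp u h1
    have he : -((y - x : ℝ) : ℂ) * gg (x + u * (y - x)) (s + 1) = (y - x) •
        (-s * HurwitzZeta.hurwitzZeta ((x + u * (y - x) : ℝ) : UnitAddCircle) (s + 1)) := by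
      rw [gg_of_ne _ (by simpa using hs0), Complex.real_smul]
      ring
    rw [he]
    exact this
  have hc : ContinuousOn (fun u : ℝ => gg (x + u * (y - x)) (s + 1)) (uIcc 0 1) := by
    rw [uIcc_of_le zero_le_one]
    exact ContinuousOn.comp HP_one (f := fun u : ℝ => (s + 1, x + u * (y - x))) (by fun_prop)
      (fun u hu => ⟨by simp; linarith, seg_mem hx hy hu⟩)
  have := intervalIntegral.integral_eq_sub_of_hasDerivAt hD
    (continuousOn_const.mul hc).intervalIntegrable
  rw [intervalIntegral.integral_const_mul] at this
  simp only [one_mul, zero_mul, add_zero, add_sub_cancel] at this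
  rw [gg_of_ne _ hs1, gg_of_ne _ hs1]
  push_cast at this
  linear_combination (-(s - 1)) * this

lemma HP_id {c : ℝ} (hc : c ≤ 1) (h : HP (c + 1)) {x y : ℝ} (hx : x ∈ Ioo (0:ℝ) 1)
    (hy : y ∈ Ioo (0:ℝ) 1) {s : ℂ} (hs : c < s.re) :
    gg y s = gg x s - (s - 1) * (y - x) * ∫ u in (0:ℝ)..1, gg (x + u * (y - x)) (s + 1) := by
  have h1 : AnalyticOnNhd ℂ (gg y) {s : ℂ | c < s.re} :=
    (gg_diff y).differentiableOn.analyticOnNhd (isOpen_hp c)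
  have h2 : AnalyticOnNhd ℂ (fun s => gg x s - (s - 1) * (y - x) *
      ∫ u in (0:ℝ)..1, gg (x + u * (y - x)) (s + 1)) {s : ℂ | c < s.re} := by
    refine DifferentiableOn.analyticOnNhd ?_ (isOpen_hp c)
    exact (gg_diff x).differentiableOn.sub (DifferentiableOn.mul (by fun_prop) (HP_Kd h hx hy))
  refine h1.eqOn_of_preconnected_of_eventuallyEq h2 (convex_halfSpace_re_gt c).isPreconnected
    (z₀ := 2) (by simp; linarith) ?_ hs
  filter_upwards [(isOpen_hp 1).mem_nhds (by simp : (2:ℂ) ∈ {s : ℂ | 1 < s.re})] with w hw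
  exact base_id hw hx hy

lemma HP_step {c : ℝ} (hc : c ≤ 1) (h : HP (c + 1)) : HP c := by
  have hh : (1/2 : ℝ) ∈ Ioo (0:ℝ) 1 := by norm_num
  have hK := (HP_K h).comp (f := fun p : ℂ × ℝ => (p.1, ((1/2 : ℝ), p.2)))
    (s := {s : ℂ | c < s.re} ×ˢ Ioo (0:ℝ) 1) (by fun_prop) (fun p hp => ⟨hp.1, hh, hp.2⟩)
  have : ContinuousOn (fun p : ℂ × ℝ => gg (1/2) p.1 - (p.1 - 1) * (p.2 - (1/2:ℝ)) *
      ∫ u in (0:ℝ)..1, gg (1/2 + u * (p.2 - 1/2)) (p.1 + 1))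
      ({s : ℂ | c < s.re} ×ˢ Ioo (0:ℝ) 1) := by
    refine ContinuousOn.sub ?_ (ContinuousOn.mul (by fun_prop) hK)
    exact ((gg_diff _).continuous.comp continuous_fst).continuousOn
  exact this.congr fun p hp => HP_id hc h hh hp.2 hp.1

lemma HP_all (c : ℝ) : HP c := by
  have hn : ∀ n : ℕ, HP (1 - n) := by
    intro n
    induction n with
    | zero => simpa using HP_one
    | succ n ih =>
      apply HP_step
      · push_cast; linarith [(Nat.cast_nonneg n : (0:ℝ) ≤ n)]
      · convert ih using 1; push_cast; ring
  obtain ⟨n, hn'⟩ := exists_nat_gt (1 - c)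
  refine (hn n).mono (prod_mono ?_ subset_rfl)
  intro s hs
  simp only [mem_ofPred_eq] at hs ⊢
  linarith

lemma Z_id {x y : ℝ} (hx : x ∈ Ioo (0:ℝ) 1) (hy : y ∈ Ioo (0:ℝ) 1) {s : ℂ} (hs : s ≠ 1) :
    HurwitzZeta.hurwitzZeta (y : UnitAddCircle) s = HurwitzZeta.hurwitzZeta (x : UnitAddCircle) s
      - (y - x) * ∫ u in (0:ℝ)..1, gg (x + u * (y - x)) (s + 1) := by
  have h := HP_id (c := min 1 (s.re - 1)) (min_le_left _ _) (HP_all _) hx hy (s := s)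
    (lt_of_le_of_lt (min_le_right _ _) (by linarith))
  rw [gg_of_ne _ hs, gg_of_ne _ hs] at h
  have h1 : s - 1 ≠ 0 := sub_ne_zero.2 hs
  apply mul_left_cancel₀ h1
  linear_combination h

theorem stmt_8 (r : ℕ) (hr : 1 ≤ r) (α : ℝ) (hα0 : 0 < α) (hα1 : α < 1)
    (s : ℂ) (hs0 : s ≠ 0) (hs1 : s ≠ 1) :
    HasDerivAt
      (fun x : ℝ =>
        iteratedDeriv r (fun w => HurwitzZeta.hurwitzZeta (x : UnitAddCircle) w) s)
      (-(r : ℂ) *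
          iteratedDeriv (r - 1)
            (fun w => HurwitzZeta.hurwitzZeta (α : UnitAddCircle) w) (s + 1)
        - s * iteratedDeriv r
            (fun w => HurwitzZeta.hurwitzZeta (α : UnitAddCircle) w) (s + 1)) α := by
  have hα : α ∈ Ioo (0:ℝ) 1 := ⟨hα0, hα1⟩
  obtain ⟨c, hc⟩ : ∃ c : ℝ, c < s.re := ⟨s.re - 1, by linarith⟩
  have hU := isOpen_hp c
  have hcont := (HP_K (HP_all (c + 1))).comp (f := fun p : ℂ × ℝ => (p.1, (α, p.2)))
    (s := {s : ℂ | c < s.re} ×ˢ Ioo (0:ℝ) 1) (by fun_prop) (fun p hp => ⟨hp.1, hα, hp.2⟩)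
  have hloc := aux_loc (f := fun s y => ∫ u in (0:ℝ)..1, gg (α + u * (y - α)) (s + 1)) hcont hα
  have hiter := (aux_iter hU r hloc (eventually_of_mem self_mem_nhdsWithin
    fun y hy => HP_Kd (HP_all _) hα hy)).tendsto_at (a := s) hc
  rw [isOpen_Ioo.nhdsWithin_eq hα] at hiter
  have hZan : ∀ (x : ℝ) (w : ℂ), w ≠ 1 → AnalyticAt ℂ
      (fun w => HurwitzZeta.hurwitzZeta (x : UnitAddCircle) w) w := by
    intro x w hw
    refine DifferentiableOn.analyticAt (s := {1}ᶜ) ?_ (isOpen_ne.mem_nhds hw)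
    intro z hz
    exact (HurwitzZeta.differentiableAt_hurwitzZeta _ hz).differentiableWithinAt
  have hlim : iteratedDeriv r (fun s => ∫ u in (0:ℝ)..1, gg (α + u * (α - α)) (s + 1)) s =
      (r : ℂ) * iteratedDeriv (r - 1)
            (fun w => HurwitzZeta.hurwitzZeta (α : UnitAddCircle) w) (s + 1)
        + s * iteratedDeriv r
            (fun w => HurwitzZeta.hurwitzZeta (α : UnitAddCircle) w) (s + 1) := by
    have he : (fun s => ∫ u in (0:ℝ)..1, gg (α + u * (α - α)) (s + 1)) =ᶠ[𝓝 s]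
        fun w => w * HurwitzZeta.hurwitzZeta (α : UnitAddCircle) (w + 1) := by
      filter_upwards [isOpen_ne.mem_nhds hs0] with w hw
      simp [gg_of_ne α (s := w + 1) (by simpa using hw)]
    have hs2 : s + 1 ≠ 1 := by simpa using hs0
    have hC : ContDiffAt ℂ r
        (fun w => HurwitzZeta.hurwitzZeta (α : UnitAddCircle) (w + 1)) s :=
      ((hZan α (s + 1) hs2).comp (f := fun w : ℂ => w + 1) (by fun_prop)).contDiffAt
    rw [he.iteratedDeriv_eq, iteratedDeriv_fun_mul (f := fun w : ℂ => w) contDiffAt_id hC, Finset.sum_range_succ',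
      Finset.sum_eq_single_of_mem 0 (Finset.mem_range.2 hr)]
    · simp [iteratedDeriv_comp_add_const (f := HurwitzZeta.hurwitzZeta (α : UnitAddCircle))]
    · intro i _ hi
      simp [iteratedDeriv_fun_id, hi]
  rw [hlim] at hiter
  rw [hasDerivAt_iff_tendsto_slope]
  have h3 := (hiter.mono_left (nhdsWithin_le_nhds (s := {α}ᶜ))).neg
  convert h3.congr' ?_ using 2
  · ring
  filter_upwards [self_mem_nhdsWithin, mem_nhdsWithin_of_mem_nhds (isOpen_Ioo.mem_nhds hα)]
    with y hyne hy
  have hyα : ((y - α : ℝ) : ℂ) ≠ 0 := by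
    exact_mod_cast sub_ne_zero.2 hyne
  have hev : (fun w => ∫ u in (0:ℝ)..1, gg (α + u * (y - α)) (w + 1)) =ᶠ[𝓝 s]
      fun w => (-((y - α : ℝ) : ℂ)⁻¹) * (HurwitzZeta.hurwitzZeta (y : UnitAddCircle) w -
        HurwitzZeta.hurwitzZeta (α : UnitAddCircle) w) := by
    filter_upwards [isOpen_ne.mem_nhds hs1] with w hw
    rw [Z_id hα hy hw]
    generalize (∫ u in (0:ℝ)..1, gg (α + u * (y - α)) (w + 1)) = J
    push_cast at hyα ⊢
    field_simp
    ring
  rw [hev.iteratedDeriv_eq, iteratedDeriv_const_mul_field,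
    iteratedDeriv_fun_sub (hZan y s hs1).contDiffAt (hZan α s hs1).contDiffAt, slope_def_module,
    Complex.real_smul]
  push_cast
  ring
end

section
/- Let r ≥ 1 be an integer, let α be a real number with 0 < α < 1, and let G : ℂ → ℂ be an entire function (Differentiable ℂ G) such that G(w) = ζ(w,α) − 1/(w−1) for all w ≠ 1; set γ_{r−1}(α) = iteratedDeriv (r−1) G 1 / (r−1)!. Then the function x ↦ ζ^{(r)}(0,x) of the real variable x has derivative −r!·γ_{r−1}(α) at x = α; i.e. HasDerivAt (fun x : ℝ => iteratedDeriv r (fun w => ζ(w,x)) 0) (−(r! : ℂ)·γ_{r−1}(α)) α. -/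
open Complex Set Filter Topology

lemma aux_cpow_deriv (c : ℂ) {t : ℝ} (ht : 0 < t) :
    HasDerivAt (fun y : ℝ => (y : ℂ) ^ c) (c * (t : ℂ) ^ (c - 1)) t := by
  have h := (hasDerivAt_id (t : ℂ)).cpow_const (c := c) (Or.inl (by simpa using ht))
  simpa using h.comp_ofReal

lemma aux_taylor (s : ℂ) (a y m : ℝ) (hm : 0 < m) (ha : m ≤ a) (hy : m ≤ y)
    (hs : -2 ≤ s.re) :
    ‖(y : ℂ) ^ (-s) - (a : ℂ) ^ (-s) + s * (y - a) * (a : ℂ) ^ (-s - 1)‖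
      ≤ ‖s‖ * ‖s + 1‖ * m ^ (-s.re - 2) * (y - a) ^ 2 := by
  have hpos : ∀ t ∈ uIcc a y, m ≤ t := fun t ht => le_trans (le_min ha hy) ht.1
  have h1 : ∀ t ∈ uIcc a y, ‖(t : ℂ) ^ (-s - 1) - (a : ℂ) ^ (-s - 1)‖
      ≤ ‖s + 1‖ * m ^ (-s.re - 2) * ‖y - a‖ := by
    intro t ht
    have := Convex.norm_image_sub_le_of_norm_hasDerivWithin_le (𝕜 := ℝ)
      (f := fun t : ℝ => (t : ℂ) ^ (-s - 1))
      (f' := fun t : ℝ => (-s - 1) * (t : ℂ) ^ (-s - 1 - 1))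
      (C := ‖s + 1‖ * m ^ (-s.re - 2)) (s := uIcc a y) (x := a) (y := t)
      (fun u hu => (aux_cpow_deriv _ (hm.trans_le (hpos u hu))).hasDerivWithinAt)
      (fun u hu => by
        rw [norm_mul, Complex.norm_cpow_eq_rpow_re_of_pos (hm.trans_le (hpos u hu)),
          show -s - 1 = -(s + 1) by ring, norm_neg]
        gcongr
        have : (-(s + 1) - 1).re = -s.re - 2 := by simp; ring
        rw [this]
        exact Real.rpow_le_rpow_of_nonpos hm (hpos u hu) (by linarith))
      (convex_uIcc a y) left_mem_uIcc ht
    refine this.trans ?_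
    gcongr
    rw [Real.norm_eq_abs, Real.norm_eq_abs]
    exact abs_sub_left_of_mem_uIcc ht
  have h2 := Convex.norm_image_sub_le_of_norm_hasDerivWithin_le (𝕜 := ℝ)
      (f := fun t : ℝ => (t : ℂ) ^ (-s) + s * (a : ℂ) ^ (-s - 1) * t)
      (f' := fun t : ℝ => (-s) * (t : ℂ) ^ (-s - 1) + s * (a : ℂ) ^ (-s - 1) * 1)
      (C := ‖s‖ * (‖s + 1‖ * m ^ (-s.re - 2) * ‖y - a‖)) (s := uIcc a y) (x := a) (y := y)
      (fun u hu => ((aux_cpow_deriv _ (hm.trans_le (hpos u hu))).add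
        ((hasDerivAt_id u).ofReal_comp.const_mul _)).hasDerivWithinAt)
      (fun u hu => by
        have : (-s) * (u : ℂ) ^ (-s - 1) + s * (a : ℂ) ^ (-s - 1) * 1
          = -(s * ((u : ℂ) ^ (-s - 1) - (a : ℂ) ^ (-s - 1))) := by ring
        rw [this, norm_neg, norm_mul]
        gcongr
        exact h1 u hu)
      (convex_uIcc a y) left_mem_uIcc right_mem_uIcc
  refine le_trans (le_of_eq ?_) (h2.trans (le_of_eq ?_))
  · congr 1; ring
  · rw [← Real.norm_of_nonneg (sq_nonneg (y - a)), norm_pow]; ring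

lemma aux_iter_s13 (H : ℂ → ℂ) (hH : Differentiable ℂ H) (k : ℕ) :
    iteratedDeriv (k + 1) (fun s => 1 + s * H s) =
      fun s => (k + 1) * iteratedDeriv k H s + s * iteratedDeriv (k + 1) H s := by
  have hd : ∀ k, Differentiable ℂ (iteratedDeriv k H) := fun k =>
    (hH.contDiff (n := ⊤)).differentiable_iteratedDeriv k (by exact_mod_cast WithTop.coe_lt_top _)
  induction k with
  | zero =>
    funext s
    rw [zero_add, iteratedDeriv_one, iteratedDeriv_zero, iteratedDeriv_one]
    have := (((hasDerivAt_id s).mul (hH s).hasDerivAt).const_add 1).deriv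
    simpa using this
  | succ k ih =>
    rw [iteratedDeriv_succ, ih]
    funext s
    have h1 := (hd k s).hasDerivAt.const_mul ((k : ℂ) + 1)
    have h2 := (hasDerivAt_id s).mul (hd (k + 1) s).hasDerivAt
    have := (h1.add h2).deriv
    rw [← iteratedDeriv_succ, ← iteratedDeriv_succ] at this
    refine Eq.trans this ?_
    push_cast
    simp
    ring

def auxU : Set ℂ := Metric.ball 0 4 ∩ {s | -(1 / 2 : ℝ) < s.re}

lemma auxU_open : IsOpen auxU :=
  Metric.isOpen_ball.inter (isOpen_lt continuous_const Complex.continuous_re)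

lemma auxU_conn : IsPreconnected auxU :=
  ((convex_ball 0 4).inter (convex_halfSpace_re_gt _)).isPreconnected

lemma aux_term (α x : ℝ) (hα0 : 0 < α) (hα1 : α < 1) (hx : α / 2 ≤ x) (n : ℕ) (s : ℂ)
    (hs : s ∈ auxU) :
    ‖((n : ℂ) + x) ^ (-s) - ((n : ℂ) + α) ^ (-s) + s * (x - α) * ((n : ℂ) + α) ^ (-s - 1)‖
      ≤ 20 * (α / 2) ^ (-6 : ℝ) * ((n : ℝ) + 1) ^ (-(3 / 2) : ℝ) * (x - α) ^ 2 := by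
  obtain ⟨h4, hre⟩ := hs
  have h4 : ‖s‖ < 4 := by simpa using h4
  have hre : -(1 / 2 : ℝ) < s.re := hre
  have hre2 : s.re < 4 := (Complex.re_le_norm s).trans_lt h4
  have hn : (0 : ℝ) ≤ n := n.cast_nonneg
  have hm : 0 < α / 2 * ((n : ℝ) + 1) := by positivity
  have key := aux_taylor s (n + α) (n + x) (α / 2 * ((n : ℝ) + 1)) hm (by nlinarith)
    (by nlinarith) (by linarith)
  push_cast at key
  have e1 : ((n : ℝ) + x - (n + α)) = x - α := by ring
  have e2 : ((n : ℂ) + x - (n + α)) = x - α := by ring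
  rw [e1, e2] at key
  refine key.trans ?_
  have h5 : ‖s + 1‖ ≤ 5 := (norm_add_le _ _).trans (by simp; linarith)
  have h6 : (α / 2 * ((n : ℝ) + 1)) ^ (-s.re - 2)
      ≤ (α / 2) ^ (-6 : ℝ) * ((n : ℝ) + 1) ^ (-(3 / 2) : ℝ) := by
    rw [Real.mul_rpow (by positivity) (by positivity)]
    refine mul_le_mul ?_ ?_ (by positivity) (by positivity)
    · exact Real.rpow_le_rpow_of_exponent_ge (by positivity) (by linarith) (by linarith)
    · exact Real.rpow_le_rpow_of_exponent_le (by linarith) (by linarith)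
  calc ‖s‖ * ‖s + 1‖ * (α / 2 * ((n : ℝ) + 1)) ^ (-s.re - 2) * (x - α) ^ 2
      ≤ 4 * 5 * ((α / 2) ^ (-6 : ℝ) * ((n : ℝ) + 1) ^ (-(3 / 2) : ℝ)) * (x - α) ^ 2 := by
        gcongr
    _ = _ := by ring

lemma aux_summ : Summable (fun n : ℕ => ((n : ℝ) + 1) ^ (-(3 / 2) : ℝ)) := by
  have := (summable_nat_add_iff 1).2 (Real.summable_nat_rpow.2 (by norm_num : (-(3 / 2) : ℝ) < -1))
  simpa using this

lemma aux_bound_s13 (α : ℝ) (hα0 : 0 < α) (hα1 : α < 1)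
    (G : ℂ → ℂ) (hG : Differentiable ℂ G)
    (hG1 : ∀ w : ℂ, w ≠ 1 →
      G w = HurwitzZeta.hurwitzZeta (α : UnitAddCircle) w - 1 / (w - 1))
    (x : ℝ) (hx : α / 2 ≤ x) (hx1 : x ≤ 1) (s : ℂ) (hs : s ∈ auxU) :
    ‖HurwitzZeta.hurwitzZeta (x : UnitAddCircle) s - HurwitzZeta.hurwitzZeta (α : UnitAddCircle) s
      + (x - α) * (1 + s * G (s + 1))‖ ≤
      (∑' n : ℕ, 20 * (α / 2) ^ (-6 : ℝ) * ((n : ℝ) + 1) ^ (-(3 / 2) : ℝ)) * (x - α) ^ 2 := by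
  set F : ℕ → ℂ → ℂ := fun n s =>
    ((n : ℂ) + x) ^ (-s) - ((n : ℂ) + α) ^ (-s) + s * (x - α) * ((n : ℂ) + α) ^ (-s - 1) with hF
  set u : ℕ → ℝ := fun n =>
    20 * (α / 2) ^ (-6 : ℝ) * ((n : ℝ) + 1) ^ (-(3 / 2) : ℝ) * (x - α) ^ 2 with hu
  have hsu : Summable u := (aux_summ.mul_left _).mul_right _
  have hle : ∀ n, ∀ w ∈ auxU, ‖F n w‖ ≤ u n := fun n w hw =>
    aux_term α x hα0 hα1 hx n w hw
  have hx0 : 0 < x := by linarith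
  have hne : ∀ y : ℝ, 0 < y → ∀ n : ℕ, (n : ℂ) + y ≠ 0 := by
    intro y hy n h
    have : ((n + y : ℝ) : ℂ) = 0 := by push_cast; exact h
    have h' : (n : ℝ) + y = 0 := by exact_mod_cast this
    have : (0 : ℝ) ≤ n := n.cast_nonneg
    linarith
  have hdiff : DifferentiableOn ℂ (fun w => ∑' n, F n w) auxU := by
    refine differentiableOn_tsum_of_summable_norm hsu (fun n => ?_) auxU_open hle
    have h1 := hne x hx0 n
    have h2 := hne α hα0 n
    refine Differentiable.differentiableOn ?_
    intro w
    refine ((differentiableAt_id.neg.const_cpow (Or.inl h1)).sub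
      (differentiableAt_id.neg.const_cpow (Or.inl h2))).add
      ((differentiableAt_id.mul_const _).mul
      ((differentiableAt_id.neg.sub_const 1).const_cpow (Or.inl h2)))
  set L : ℂ → ℂ := fun s => HurwitzZeta.hurwitzZeta (x : UnitAddCircle) s
    - HurwitzZeta.hurwitzZeta (α : UnitAddCircle) s + (x - α) * (1 + s * G (s + 1)) with hL
  have hLd : Differentiable ℂ L := by
    refine (HurwitzZeta.differentiable_hurwitzZeta_sub_hurwitzZeta _ _).add ?_
    have : Differentiable ℂ (fun s => G (s + 1)) := hG.comp (differentiable_id.add_const 1)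
    fun_prop
  have heq : EqOn L (fun w => ∑' n, F n w) auxU := by
    refine (hLd.differentiableOn.analyticOnNhd auxU_open).eqOn_of_preconnected_of_eventuallyEq
      (hdiff.analyticOnNhd auxU_open) auxU_conn (z₀ := 2) ?_ ?_
    · constructor
      · simp
        norm_num
      · simp
        norm_num
    · have : {w : ℂ | 1 < w.re} ∈ 𝓝 (2 : ℂ) :=
        (isOpen_lt continuous_const Complex.continuous_re).mem_nhds (by simp)
      filter_upwards [this] with w hw
      have hw : 1 < w.re := hw
      have hw0 : w ≠ 0 := by rintro rfl; simp at hw; linarith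
      have s1 := HurwitzZeta.hasSum_hurwitzZeta_of_one_lt_re (a := x) ⟨hx0.le, hx1⟩ hw
      have s2 := HurwitzZeta.hasSum_hurwitzZeta_of_one_lt_re (a := α) ⟨hα0.le, hα1.le⟩ hw
      have s3 := HurwitzZeta.hasSum_hurwitzZeta_of_one_lt_re (a := α) ⟨hα0.le, hα1.le⟩
        (s := w + 1) (by simp; linarith)
      have := ((s1.sub s2).add (s3.mul_left (w * (x - α)))).tsum_eq
      have e : ∀ n, F n w = 1 / ((n : ℂ) + x) ^ w - 1 / ((n : ℂ) + α) ^ w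
          + w * (x - α) * (1 / ((n : ℂ) + α) ^ (w + 1)) := by
        intro n
        simp only [hF]
        rw [show -w - 1 = -(w + 1) by ring, cpow_neg, cpow_neg, cpow_neg]
        simp only [one_div]
      simp only [e]
      rw [this, hL]
      simp only
      rw [hG1 (w + 1) (by simpa using hw0)]
      have : w + 1 - 1 = w := by ring
      rw [this]
      field_simp
      ring
  have : ‖∑' n, F n s‖ ≤ ∑' n, u n :=
    tsum_of_norm_bounded hsu.hasSum (fun n => hle n s hs)
  rw [← tsum_mul_right]
  have h2 : L s = ∑' n, F n s := heq hs
  rw [← h2] at this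
  exact this

theorem stmt_13 (r : ℕ) (hr : 1 ≤ r) (α : ℝ) (hα0 : 0 < α) (hα1 : α < 1)
    (G : ℂ → ℂ) (hG : Differentiable ℂ G)
    (hG1 : ∀ w : ℂ, w ≠ 1 →
      G w = HurwitzZeta.hurwitzZeta (α : UnitAddCircle) w - 1 / (w - 1)) :
    HasDerivAt
      (fun x : ℝ =>
        iteratedDeriv r (fun w => HurwitzZeta.hurwitzZeta (x : UnitAddCircle) w) 0)
      (-(r.factorial : ℂ) * (iteratedDeriv (r - 1) G 1 / ((r - 1).factorial : ℂ))) α := by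
  obtain ⟨k, rfl⟩ : ∃ k, r = k + 1 := ⟨r - 1, by omega⟩
  rw [Nat.add_sub_cancel]
  have hfac : -((k + 1).factorial : ℂ) * (iteratedDeriv k G 1 / (k.factorial : ℂ))
      = -((k + 1) * iteratedDeriv k G 1) := by
    have : (k.factorial : ℂ) ≠ 0 := by exact_mod_cast k.factorial_ne_zero
    rw [Nat.factorial_succ]
    push_cast
    field_simp
  rw [hfac]
  set K := ∑' n : ℕ, 20 * (α / 2) ^ (-6 : ℝ) * ((n : ℝ) + 1) ^ (-(3 / 2) : ℝ) with hK
  set C : ℝ := (k + 1).factorial * K / (1 / 4 : ℝ) ^ (k + 1) with hC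
  have hGs : Differentiable ℂ (fun s => G (s + 1)) := hG.comp (differentiable_id.add_const 1)
  have hcd : ∀ a : UnitAddCircle, ContDiffAt ℂ (k + 1 : ℕ) (HurwitzZeta.hurwitzZeta a) 0 := by
    intro a
    have : DifferentiableOn ℂ (HurwitzZeta.hurwitzZeta a) {1}ᶜ := fun w hw =>
      (HurwitzZeta.differentiableAt_hurwitzZeta a hw).differentiableWithinAt
    exact (this.analyticAt (isOpen_compl_singleton.mem_nhds (by simp))).contDiffAt
  have main : ∀ x : ℝ, α / 2 ≤ x → x ≤ 1 →
      ‖iteratedDeriv (k + 1) (HurwitzZeta.hurwitzZeta (x : UnitAddCircle)) 0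
        - iteratedDeriv (k + 1) (HurwitzZeta.hurwitzZeta (α : UnitAddCircle)) 0
        + (x - α) * ((k + 1) * iteratedDeriv k G 1)‖ ≤ C * (x - α) ^ 2 := by
    intro x hx hx1
    have hQ : Differentiable ℂ (fun s => 1 + s * G (s + 1)) := by fun_prop
    have hd : Differentiable ℂ (fun s => (HurwitzZeta.hurwitzZeta (x : UnitAddCircle) s
      - HurwitzZeta.hurwitzZeta (α : UnitAddCircle) s) + (x - α) * (1 + s * G (s + 1))) :=
      (HurwitzZeta.differentiable_hurwitzZeta_sub_hurwitzZeta _ _).add (hQ.const_mul _)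
    have hb := Complex.norm_iteratedDeriv_le_of_forall_mem_sphere_norm_le (c := 0) (R := 1 / 4)
      (C := K * (x - α) ^ 2) (k + 1) (by norm_num) hd.diffContOnCl (by
        intro z hz
        have hz : ‖z‖ = 1 / 4 := by simpa using hz
        refine aux_bound_s13 α hα0 hα1 G hG hG1 x hx hx1 z ⟨?_, ?_⟩
        · simp [hz]; norm_num
        · have := (abs_le.1 (Complex.abs_re_le_norm z)).1
          rw [hz] at this
          show -(1 / 2 : ℝ) < z.re
          linarith)
    rw [iteratedDeriv_fun_add (((hcd _).sub (hcd _))) ((hQ.const_mul _).contDiff.contDiffAt),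
      iteratedDeriv_fun_sub (hcd _) (hcd _), iteratedDeriv_const_mul_field,
      aux_iter_s13 _ hGs, iteratedDeriv_comp_add_const] at hb
    simp only [zero_mul, add_zero, zero_add] at hb
    refine hb.trans (le_of_eq ?_)
    rw [hC]; ring
  refine HasDerivAt.of_isLittleO ?_
  have hO : (fun x : ℝ => iteratedDeriv (k + 1)
        (fun w => HurwitzZeta.hurwitzZeta (x : UnitAddCircle) w) 0
        - iteratedDeriv (k + 1) (fun w => HurwitzZeta.hurwitzZeta (α : UnitAddCircle) w) 0
        - (x - α) • (-((k + 1) * iteratedDeriv k G 1)))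
        =O[𝓝 α] fun x : ℝ => (x - α) ^ 2 := by
    refine Asymptotics.IsBigO.of_bound C ?_
    filter_upwards [Icc_mem_nhds (by linarith : α / 2 < α) hα1] with x hx
    have := main x hx.1 hx.2
    rw [Real.norm_of_nonneg (sq_nonneg _)]
    refine le_trans (le_of_eq ?_) this
    congr 1
    rw [Complex.real_smul]
    push_cast
    ring
  refine hO.trans_isLittleO ?_
  simpa using Asymptotics.isLittleO_pow_sub_sub α (m := 2) (by norm_num)
end
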